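/- arXiv:2603.08155 — 2 statements merged into one kernel-verified Lean document; each statement's English description precedes it below -/
import Mathlib

section
/- Let n be a positive natural number and R > 0, and write s_t = 1 - e^{-2t}. Let p₀ and q₀ be probability density functions on ℝⁿ that vanish outside the closed ball of radius R centered at the origin. For t > 0 define p_t(x) = ∫_{ℝⁿ} (2π s_t)^{-n/2} · exp( -‖x - e^{-t}x₀‖²/(2 s_t) ) · p₀(x₀) dx₀ and q_t analogously with q₀ in place of p₀. Then the function t ↦ KL(p_t ‖ q_t) = ∫_{ℝⁿ} p_t(x) · log( p_t(x)/q_t(x) ) dx is differentiable on (0, ∞), and for every t > 0 its derivative satisfies d/dt KL(p_t ‖ q_t) = - I(p_t ‖ q_t), where I(p_t ‖ q_t) = ∫_{ℝⁿ} p_t(x) · ‖∇ log p_t(x) - ∇ log q_t(x)‖² dx is the relative Fisher information. -/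
open MeasureTheory Real
open scoped BigOperators

noncomputable section

/-- The transition density of the Ornstein–Uhlenbeck process `dX = -X dt + √2 dW`. -/
def ouKernel {n : ℕ} (t : ℝ) (x y : EuclideanSpace ℝ (Fin n)) : ℝ :=
  (2 * π * (1 - Real.exp (-2 * t))) ^ (-(n : ℝ) / 2) *
    Real.exp (-‖x - Real.exp (-t) • y‖ ^ 2 / (2 * (1 - Real.exp (-2 * t))))

/-- The image of `h` under the Ornstein–Uhlenbeck evolution at time `t`. -/
def ouFlow {n : ℕ} (h : EuclideanSpace ℝ (Fin n) → ℝ) (t : ℝ)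
    (x : EuclideanSpace ℝ (Fin n)) : ℝ :=
  ∫ y, ouKernel t x y * h y

/-- `h` is integrable and vanishes outside the closed ball of radius `R`. -/
structure IntegrableInBall {n : ℕ} (R : ℝ) (h : EuclideanSpace ℝ (Fin n) → ℝ) : Prop where
  integrable : Integrable h
  eq_zero : ∀ x, x ∉ Metric.closedBall (0 : EuclideanSpace ℝ (Fin n)) R → h x = 0

/-- `h` is a probability density supported in the closed ball of radius `R`. -/
structure IsDensityInBall {n : ℕ} (R : ℝ) (h : EuclideanSpace ℝ (Fin n) → ℝ) : Prop
    extends IntegrableInBall R h where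
  nonneg : ∀ x, 0 ≤ h x
  integral_eq_one : ∫ x, h x = 1

section Kernel

variable {n : ℕ} {R : ℝ} {h g : EuclideanSpace ℝ (Fin n) → ℝ}

theorem one_sub_exp_neg_pos {t : ℝ} (ht : 0 < t) : 0 < 1 - Real.exp (-2 * t) := by
  have : Real.exp (-2 * t) < 1 := Real.exp_lt_one_iff.mpr (by linarith)
  linarith

theorem exp_neg_two_mul (t : ℝ) : Real.exp (-2 * t) = Real.exp (-t) ^ 2 := by
  rw [← Real.exp_nat_mul]; congr 1; push_cast; ring

theorem IntegrableInBall.mul_left (hh : IntegrableInBall R h) (hg : Continuous g) :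
    IntegrableInBall R fun y => g y * h y := by
  obtain ⟨B, hB⟩ := (isCompact_closedBall
    (0 : EuclideanSpace ℝ (Fin n)) R).exists_bound_of_continuousOn hg.continuousOn
  refine ⟨(hh.integrable.norm.const_mul B).mono'
    (hg.aestronglyMeasurable.mul hh.integrable.1) (ae_of_all _ fun y => ?_), fun y hy => ?_⟩
  · by_cases hy : y ∈ Metric.closedBall (0 : EuclideanSpace ℝ (Fin n)) R
    · rw [norm_mul]; gcongr; exact hB y hy
    · simp [hh.eq_zero y hy]
  · simp [hh.eq_zero y hy]

/-- Differentiation under the integral sign against an integrable function with bounded support. -/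
theorem IntegrableInBall.exists_hasFDerivAt_integral_mul {H : Type*} [NormedAddCommGroup H]
    [NormedSpace ℝ H] [LocallyCompactSpace H] (hh : IntegrableInBall R h)
    {k : H → EuclideanSpace ℝ (Fin n) → ℝ} {k' : H → EuclideanSpace ℝ (Fin n) → H →L[ℝ] ℝ}
    {U : Set H} (hU : IsOpen U) (hk : ∀ z ∈ U, ∀ y, HasFDerivAt (k · y) (k' z y) z)
    (hkc : ∀ z ∈ U, Continuous (k z))
    (hk' : ContinuousOn (fun w : H × EuclideanSpace ℝ (Fin n) => k' w.1 w.2) (U ×ˢ Set.univ))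
    {z : H} (hz : z ∈ U) :
    ∃ D : H →L[ℝ] ℝ, HasFDerivAt (fun z => ∫ y, k z y * h y) D z ∧
      ∀ v, D v = ∫ y, k' z y v * h y := by
  obtain ⟨N, hNz, hNU, hNc⟩ := local_compact_nhds (hU.mem_nhds hz)
  obtain ⟨C, hC⟩ := (hNc.prod (isCompact_closedBall
    (0 : EuclideanSpace ℝ (Fin n)) R)).exists_bound_of_continuousOn
    (hk'.mono (Set.prod_mono hNU (Set.subset_univ _)))
  have hk'z : Continuous (k' z) := by
    have : Continuous fun y => ((z, y) : H × EuclideanSpace ℝ (Fin n)) := by fun_prop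
    exact hk'.comp_continuous this fun y => ⟨hz, Set.mem_univ _⟩
  have hbound : ∀ y, ∀ z ∈ N, ‖h y • k' z y‖ ≤ C * ‖h y‖ := by
    intro y w hw
    by_cases hy : y ∈ Metric.closedBall (0 : EuclideanSpace ℝ (Fin n)) R
    · rw [norm_smul, mul_comm]; gcongr; exact hC (w, y) ⟨hw, hy⟩
    · simp [hh.eq_zero y hy]
  have hmeas : AEStronglyMeasurable (fun y => h y • k' z y) volume :=
    hh.integrable.1.smul hk'z.aestronglyMeasurable
  have hbint : Integrable fun y => C * ‖h y‖ := hh.integrable.norm.const_mul C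
  refine ⟨∫ y, h y • k' z y, ?_, fun v => ?_⟩
  · refine hasFDerivAt_integral_of_dominated_of_fderiv_le (bound := fun y => C * ‖h y‖) hNz ?_
      (hh.mul_left (hkc z hz)).integrable hmeas (ae_of_all _ hbound) hbint
      (ae_of_all _ fun y w hw => ?_)
    · filter_upwards [hU.mem_nhds hz] with w hw
      exact (hkc w hw).aestronglyMeasurable.mul hh.integrable.1
    · exact (hk w (hNU hw) y).mul_const (h y)
  · have hi : Integrable fun y => h y • k' z y :=
      hbint.mono' hmeas (ae_of_all _ fun y => hbound y z (mem_of_mem_nhds hNz))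
    rw [ContinuousLinearMap.integral_apply hi]
    simp [mul_comm]

theorem continuous_ouKernel (t : ℝ) (x : EuclideanSpace ℝ (Fin n)) : Continuous (ouKernel t x) := by
  unfold ouKernel; fun_prop

theorem ouKernel_pos {t : ℝ} (ht : 0 < t) (x y : EuclideanSpace ℝ (Fin n)) :
    0 < ouKernel t x y := by
  have := one_sub_exp_neg_pos ht
  unfold ouKernel; positivity

theorem IntegrableInBall.integrable_ouKernel_mul (hh : IntegrableInBall R h) {t : ℝ}
    (x : EuclideanSpace ℝ (Fin n)) : Integrable fun y => ouKernel t x y * h y :=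
  (hh.mul_left (continuous_ouKernel t x)).integrable

theorem hasFDerivAt_ouKernel (t : ℝ) (x y : EuclideanSpace ℝ (Fin n)) :
    HasFDerivAt (fun x => ouKernel t x y)
      (-(ouKernel t x y / (1 - Real.exp (-2 * t))) • innerSL ℝ (x - Real.exp (-t) • y)) x := by
  have h1 : HasFDerivAt (fun x : EuclideanSpace ℝ (Fin n) => ‖x - Real.exp (-t) • y‖ ^ 2)
      (2 • (innerSL ℝ (x - Real.exp (-t) • y)).comp
        (ContinuousLinearMap.id ℝ (EuclideanSpace ℝ (Fin n)))) x :=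
    ((hasFDerivAt_id x).sub_const (Real.exp (-t) • y)).norm_sq
  have h2 := ((h1.const_mul (-1 / (2 * (1 - Real.exp (-2 * t))))).exp).const_mul
    ((2 * π * (1 - Real.exp (-2 * t))) ^ (-(n : ℝ) / 2))
  refine (h2.congr_fderiv ?_).congr_of_eventuallyEq (Filter.Eventually.of_forall fun z => ?_)
  · ext v
    simp only [ouKernel, smul_apply, ContinuousLinearMap.comp_id, smul_eq_mul,
      nsmul_eq_mul, Nat.cast_ofNat]
    rw [show -1 / (2 * (1 - Real.exp (-2 * t))) * ‖x - Real.exp (-t) • y‖ ^ 2 =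
      -‖x - Real.exp (-t) • y‖ ^ 2 / (2 * (1 - Real.exp (-2 * t))) by ring]
    generalize 1 - Real.exp (-2 * t) = s
    ring
  · simp only [ouKernel]
    congr 2; ring

theorem hasDerivAt_ouKernel {t : ℝ} (ht : 0 < t) (x y : EuclideanSpace ℝ (Fin n)) :
    HasDerivAt (fun t => ouKernel t x y)
      (ouKernel t x y * (-(n * Real.exp (-t) ^ 2 / (1 - Real.exp (-2 * t)))
        - inner ℝ (x - Real.exp (-t) • y) (Real.exp (-t) • y) / (1 - Real.exp (-2 * t))
        + ‖x - Real.exp (-t) • y‖ ^ 2 * Real.exp (-t) ^ 2 / (1 - Real.exp (-2 * t)) ^ 2)) t := by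
  have hs := one_sub_exp_neg_pos ht
  have he : HasDerivAt (fun t : ℝ => Real.exp (-t)) (-Real.exp (-t)) t := by
    simpa using (hasDerivAt_neg t).exp
  have hvar : HasDerivAt (fun t : ℝ => 1 - Real.exp (-2 * t)) (2 * Real.exp (-t) ^ 2) t := by
    have := (((hasDerivAt_id t).const_mul (-2)).exp).const_sub 1
    refine this.congr_deriv ?_
    simp only [id, exp_neg_two_mul]; ring
  have hz : HasDerivAt (fun t : ℝ => x - Real.exp (-t) • y) (Real.exp (-t) • y) t := by
    have := (he.smul_const y).const_sub x
    refine this.congr_deriv ?_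
    simp
  have hn := (hz.norm_sq.neg).div (hvar.const_mul 2) (by positivity)
  have hc := (hvar.const_mul (2 * π)).rpow_const (p := -(n : ℝ) / 2) (Or.inl (by positivity))
  refine (hc.mul hn.exp).congr_deriv ?_
  simp only [ouKernel, Pi.neg_apply, Pi.div_apply]
  rw [Real.rpow_sub_one (by positivity)]
  field_simp
  ring

theorem IntegrableInBall.exists_hasFDerivAt_ouFlow (hh : IntegrableInBall R h) (t : ℝ)
    (x : EuclideanSpace ℝ (Fin n)) :
    ∃ D : EuclideanSpace ℝ (Fin n) →L[ℝ] ℝ, HasFDerivAt (ouFlow h t) D x ∧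
      ∀ i, D (EuclideanSpace.single i 1) = (-(x i) * ouFlow h t x
        + Real.exp (-t) * ouFlow (fun y => y i * h y) t x) / (1 - Real.exp (-2 * t)) := by
  obtain ⟨D, hD, hDv⟩ := hh.exists_hasFDerivAt_integral_mul (k := fun x y => ouKernel t x y)
    (k' := fun x y => -(ouKernel t x y / (1 - Real.exp (-2 * t))) •
      innerSL ℝ (x - Real.exp (-t) • y))
    isOpen_univ (fun x _ y => hasFDerivAt_ouKernel t x y) (fun x _ => continuous_ouKernel t x)
    (by
      apply Continuous.continuousOn
      unfold ouKernel
      fun_prop) (Set.mem_univ x)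
  refine ⟨D, hD, fun i => ?_⟩
  have hi : IntegrableInBall R fun y => y i * h y := hh.mul_left (by fun_prop)
  rw [hDv, ouFlow, ouFlow, ← integral_const_mul, ← integral_const_mul, ← integral_add
    ((hh.integrable_ouKernel_mul x).const_mul _) ((hi.integrable_ouKernel_mul x).const_mul _),
    ← integral_div]
  congr 1 with y
  simp [EuclideanSpace.inner_single_right]
  ring

theorem IntegrableInBall.continuous_ouFlow (hh : IntegrableInBall R h) (t : ℝ) :
    Continuous (ouFlow h t) :=
  continuous_iff_continuousAt.2 fun x =>
    (hh.exists_hasFDerivAt_ouFlow t x).choose_spec.1.continuousAt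

theorem IntegrableInBall.hasDerivAt_ouFlow (hh : IntegrableInBall R h) {t : ℝ} (ht : 0 < t)
    (x : EuclideanSpace ℝ (Fin n)) :
    HasDerivAt (fun t => ouFlow h t x)
      (∑ i, (-(Real.exp (-t) ^ 2 / (1 - Real.exp (-2 * t))) * ouFlow h t x
        - (Real.exp (-t) * x i * ouFlow (fun y => y i * h y) t x
          - Real.exp (-t) ^ 2 * ouFlow (fun y => y i ^ 2 * h y) t x) / (1 - Real.exp (-2 * t))
        + (x i ^ 2 * ouFlow h t x
          - 2 * Real.exp (-t) * x i * ouFlow (fun y => y i * h y) t x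
          + Real.exp (-t) ^ 2 * ouFlow (fun y => y i ^ 2 * h y) t x)
            * Real.exp (-t) ^ 2 / (1 - Real.exp (-2 * t)) ^ 2)) t := by
  obtain ⟨D, hD, hDv⟩ := hh.exists_hasFDerivAt_integral_mul (k := fun t y => ouKernel t x y)
    (k' := fun t y => ContinuousLinearMap.toSpanSingleton ℝ
      (ouKernel t x y * (-(n * Real.exp (-t) ^ 2 / (1 - Real.exp (-2 * t)))
        - inner ℝ (x - Real.exp (-t) • y) (Real.exp (-t) • y) / (1 - Real.exp (-2 * t))
        + ‖x - Real.exp (-t) • y‖ ^ 2 * Real.exp (-t) ^ 2 / (1 - Real.exp (-2 * t)) ^ 2)))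
    isOpen_Ioi (fun t ht y => (hasDerivAt_ouKernel ht x y).hasFDerivAt)
    (fun t _ => continuous_ouKernel t x)
    (by
      have hs : ∀ w ∈ Set.Ioi (0 : ℝ) ×ˢ (Set.univ : Set (EuclideanSpace ℝ (Fin n))),
          1 - Real.exp (-2 * w.1) ≠ 0 := fun w hw => (one_sub_exp_neg_pos hw.1).ne'
      have hsm : ∀ w ∈ Set.Ioi (0 : ℝ) ×ˢ (Set.univ : Set (EuclideanSpace ℝ (Fin n))),
          2 * π * (1 - Real.exp (-2 * w.1)) ≠ 0 := fun w hw =>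
        mul_ne_zero (by positivity) (hs w hw)
      have hs2 : ∀ w ∈ Set.Ioi (0 : ℝ) ×ˢ (Set.univ : Set (EuclideanSpace ℝ (Fin n))),
          2 * (1 - Real.exp (-2 * w.1)) ≠ 0 := fun w hw => mul_ne_zero two_ne_zero (hs w hw)
      have hs3 : ∀ w ∈ Set.Ioi (0 : ℝ) ×ˢ (Set.univ : Set (EuclideanSpace ℝ (Fin n))),
          (1 - Real.exp (-2 * w.1)) ^ 2 ≠ 0 := fun w hw => pow_ne_zero 2 (hs w hw)
      refine (ContinuousLinearMap.toSpanSingletonCLE (𝕜 := ℝ)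
        (E := ℝ)).continuous.comp_continuousOn ?_
      unfold ouKernel
      refine ContinuousOn.mul (ContinuousOn.mul ?_ ?_) ?_
      · exact ContinuousOn.rpow_const (by fun_prop) fun w hw => Or.inl (hsm w hw)
      · exact (ContinuousOn.div (by fun_prop) (by fun_prop) hs2).rexp
      · exact ((ContinuousOn.div (by fun_prop) (by fun_prop) hs).neg.sub
          (ContinuousOn.div (by fun_prop) (by fun_prop) hs)).add
          (ContinuousOn.div (by fun_prop) (by fun_prop) hs3))
    (Set.mem_Ioi.2 ht)
  refine (hD.hasDerivAt.congr_deriv ?_)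
  have hi (i : Fin n) : IntegrableInBall R fun y => y i * h y := hh.mul_left (by fun_prop)
  have hi2 (i : Fin n) : IntegrableInBall R fun y => y i ^ 2 * h y := hh.mul_left (by fun_prop)
  have h0 := hh.integrable_ouKernel_mul (t := t) x
  have h1 := fun i => (hi i).integrable_ouKernel_mul (t := t) x
  have h2 := fun i => (hi2 i).integrable_ouKernel_mul (t := t) x
  have hlin (i : Fin n) (a b c : ℝ) :
      ∫ y, (a * (ouKernel t x y * h y) + b * (ouKernel t x y * (y i * h y))
        + c * (ouKernel t x y * (y i ^ 2 * h y))) =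
      a * ouFlow h t x + b * ouFlow (fun y => y i * h y) t x
        + c * ouFlow (fun y => y i ^ 2 * h y) t x := by
    have h01 : Integrable fun y => a * (ouKernel t x y * h y)
        + b * (ouKernel t x y * (y i * h y)) := (h0.const_mul a).add ((h1 i).const_mul b)
    rw [integral_add h01 ((h2 i).const_mul c),
      integral_add (h0.const_mul a) ((h1 i).const_mul b), integral_const_mul, integral_const_mul,
      integral_const_mul]
    rfl
  set e := Real.exp (-t) with he
  set s := 1 - Real.exp (-2 * t) with hs
  calc D 1 = ∫ y, ∑ i, ((-(e ^ 2 / s) + x i ^ 2 * e ^ 2 / s ^ 2) * (ouKernel t x y * h y)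
        + (-(e * x i) / s - 2 * e * x i * e ^ 2 / s ^ 2) * (ouKernel t x y * (y i * h y))
        + (e ^ 2 / s + e ^ 2 * e ^ 2 / s ^ 2) * (ouKernel t x y * (y i ^ 2 * h y))) := by
        rw [hDv]
        congr 1 with y
        have hin : inner ℝ (x - e • y) (e • y) = ∑ i, (x i - e * y i) * (e * y i) := by
          simp [PiLp.inner_apply, mul_comm]
        have hno : ‖x - e • y‖ ^ 2 = ∑ i, (x i - e * y i) ^ 2 := by
          simp [EuclideanSpace.real_norm_sq_eq]
        have hcard : (n : ℝ) = ∑ _i : Fin n, (1 : ℝ) := by simp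
        simp only [ContinuousLinearMap.toSpanSingleton_apply, one_smul]
        rw [hin, hno, hcard]
        simp only [Finset.sum_mul, Finset.sum_div, Finset.mul_sum, ← Finset.sum_neg_distrib,
          ← Finset.sum_add_distrib, ← Finset.sum_sub_distrib]
        refine Finset.sum_congr rfl fun i _ => ?_
        ring
    _ = _ := by
        refine (integral_finsetSum _ fun i _ => ((h0.const_mul _).add ((h1 i).const_mul _)).add
          ((h2 i).const_mul _)).trans ?_
        refine Finset.sum_congr rfl fun i _ => ?_
        refine (hlin i _ _ _).trans ?_
        ring

end Kernel

section Bounds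

variable {n : ℕ} {R : ℝ} {h g : EuclideanSpace ℝ (Fin n) → ℝ}

theorem ouKernel_eq_mul_exp {t : ℝ} (x y : EuclideanSpace ℝ (Fin n)) :
    ouKernel t x y = ouKernel t x 0 * Real.exp
      ((Real.exp (-t) * inner ℝ x y - Real.exp (-t) ^ 2 * ‖y‖ ^ 2 / 2)
        / (1 - Real.exp (-2 * t))) := by
  unfold ouKernel
  rw [mul_assoc (_ ^ _), ← Real.exp_add]
  congr 2
  rw [@norm_sub_sq ℝ, norm_smul, inner_smul_right, smul_zero, sub_zero, mul_pow, Real.norm_eq_abs,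
    sq_abs]
  simp only [RCLike.re_to_real]
  generalize 1 - Real.exp (-2 * t) = s
  ring

theorem abs_ouKernel_exponent_le {t : ℝ} (ht : 0 < t) (x : EuclideanSpace ℝ (Fin n))
    {y : EuclideanSpace ℝ (Fin n)} (hy : ‖y‖ ≤ R) :
    |(Real.exp (-t) * inner ℝ x y - Real.exp (-t) ^ 2 * ‖y‖ ^ 2 / 2)
        / (1 - Real.exp (-2 * t))| ≤ R * (‖x‖ + R) / (1 - Real.exp (-2 * t)) := by
  have hs := one_sub_exp_neg_pos ht
  have he : Real.exp (-t) ≤ 1 := Real.exp_le_one_iff.2 (by linarith)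
  have he0 := Real.exp_pos (-t)
  have hR : 0 ≤ R := (norm_nonneg y).trans hy
  rw [abs_div, abs_of_pos hs]
  gcongr
  have h1 : |Real.exp (-t) * inner ℝ x y| ≤ 1 * (‖x‖ * R) := by
    rw [abs_mul, abs_of_pos he0]
    gcongr
    exact (abs_real_inner_le_norm x y).trans (by gcongr)
  have h2 : |Real.exp (-t) ^ 2 * ‖y‖ ^ 2 / 2| ≤ 1 ^ 2 * R ^ 2 / 1 := by
    rw [abs_of_nonneg (by positivity)]
    gcongr
    norm_num
  have := abs_sub (Real.exp (-t) * inner ℝ x y) (Real.exp (-t) ^ 2 * ‖y‖ ^ 2 / 2)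
  nlinarith

theorem IsDensityInBall.ouFlow_le (hh : IsDensityInBall R h) {t : ℝ} (ht : 0 < t)
    (x : EuclideanSpace ℝ (Fin n)) :
    ouFlow h t x ≤ ouKernel t x 0 * Real.exp (R * (‖x‖ + R) / (1 - Real.exp (-2 * t))) := by
  have hK := (ouKernel_pos ht x 0).le
  calc ouFlow h t x
      ≤ ∫ y, ouKernel t x 0 * Real.exp (R * (‖x‖ + R) / (1 - Real.exp (-2 * t))) * h y := by
        refine integral_mono (hh.integrable_ouKernel_mul x) (hh.integrable.const_mul _) fun y => ?_
        by_cases hy : y ∈ Metric.closedBall (0 : EuclideanSpace ℝ (Fin n)) R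
        · have := hh.nonneg y
          simp only
          rw [ouKernel_eq_mul_exp x y]
          gcongr ouKernel t x 0 * Real.exp ?_ * h y
          exact (abs_le.1 (abs_ouKernel_exponent_le ht x (by simpa using hy))).2
        · simp [hh.eq_zero y hy]
    _ = _ := by rw [integral_const_mul, hh.integral_eq_one, mul_one]

theorem IsDensityInBall.le_ouFlow (hh : IsDensityInBall R h) {t : ℝ} (ht : 0 < t)
    (x : EuclideanSpace ℝ (Fin n)) :
    ouKernel t x 0 * Real.exp (-(R * (‖x‖ + R) / (1 - Real.exp (-2 * t)))) ≤ ouFlow h t x := by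
  have hK := (ouKernel_pos ht x 0).le
  calc ouKernel t x 0 * Real.exp (-(R * (‖x‖ + R) / (1 - Real.exp (-2 * t))))
      = ∫ y, ouKernel t x 0 * Real.exp (-(R * (‖x‖ + R) / (1 - Real.exp (-2 * t)))) * h y := by
        rw [integral_const_mul, hh.integral_eq_one, mul_one]
    _ ≤ ouFlow h t x := by
        refine integral_mono (hh.integrable.const_mul _) (hh.integrable_ouKernel_mul x) fun y => ?_
        by_cases hy : y ∈ Metric.closedBall (0 : EuclideanSpace ℝ (Fin n)) R
        · have := hh.nonneg y
          simp only
          rw [ouKernel_eq_mul_exp x y]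
          gcongr
          exact (abs_le.1 (abs_ouKernel_exponent_le ht x (by simpa using hy))).1
        · simp [hh.eq_zero y hy]

theorem IsDensityInBall.ouFlow_pos (hh : IsDensityInBall R h) {t : ℝ} (ht : 0 < t)
    (x : EuclideanSpace ℝ (Fin n)) : 0 < ouFlow h t x :=
  (mul_pos (ouKernel_pos ht x 0) (Real.exp_pos _)).trans_le (hh.le_ouFlow ht x)

theorem IsDensityInBall.log_ouFlow_div_le (hh : IsDensityInBall R h) (hg : IsDensityInBall R g)
    {t : ℝ} (ht : 0 < t) (x : EuclideanSpace ℝ (Fin n)) :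
    Real.log (ouFlow h t x / ouFlow g t x) ≤ 2 * (R * (‖x‖ + R) / (1 - Real.exp (-2 * t))) := by
  have hP := hh.ouFlow_pos ht x
  have hQ := hg.ouFlow_pos ht x
  have hK := ouKernel_pos ht x 0
  rw [Real.log_le_iff_le_exp (by positivity), div_le_iff₀ hQ]
  calc ouFlow h t x ≤ ouKernel t x 0 * Real.exp (R * (‖x‖ + R) / (1 - Real.exp (-2 * t))) :=
        hh.ouFlow_le ht x
    _ = Real.exp (2 * (R * (‖x‖ + R) / (1 - Real.exp (-2 * t)))) *
        (ouKernel t x 0 * Real.exp (-(R * (‖x‖ + R) / (1 - Real.exp (-2 * t))))) := by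
        rw [mul_left_comm, ← Real.exp_add]; congr 2; ring
    _ ≤ _ := by gcongr; exact hg.le_ouFlow ht x

theorem IsDensityInBall.abs_log_ouFlow_div_le (hh : IsDensityInBall R h)
    (hg : IsDensityInBall R g) {t : ℝ} (ht : 0 < t) (x : EuclideanSpace ℝ (Fin n)) :
    |Real.log (ouFlow h t x / ouFlow g t x)| ≤
      2 * (R * (‖x‖ + R) / (1 - Real.exp (-2 * t))) := by
  refine abs_le'.2 ⟨hh.log_ouFlow_div_le hg ht x, ?_⟩
  rw [← Real.log_inv, inv_div]
  exact hg.log_ouFlow_div_le hh ht x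

theorem IsDensityInBall.abs_ouFlow_mul_div_le (hh : IsDensityInBall R h) (hg : Continuous g)
    {B : ℝ} (hB : ∀ y, ‖y‖ ≤ R → |g y| ≤ B) {t : ℝ} (ht : 0 < t)
    (x : EuclideanSpace ℝ (Fin n)) :
    |ouFlow (fun y => g y * h y) t x / ouFlow h t x| ≤ B := by
  have hP := hh.ouFlow_pos ht x
  rw [abs_div, abs_of_pos hP, div_le_iff₀ hP, ouFlow, ouFlow, ← integral_const_mul]
  refine (abs_integral_le_integral_abs).trans (integral_mono
    ((hh.mul_left hg).integrable_ouKernel_mul x).abs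
    ((hh.integrable_ouKernel_mul x).const_mul B) fun y => ?_)
  by_cases hy : y ∈ Metric.closedBall (0 : EuclideanSpace ℝ (Fin n)) R
  · have hK := (ouKernel_pos ht x y).le
    have := hh.nonneg y
    simp only
    rw [abs_mul, abs_mul, abs_of_nonneg hK, abs_of_nonneg this, mul_left_comm]
    gcongr
    exact hB y (by simpa using hy)
  · simp [hh.eq_zero y hy]

/-- On times larger than `a`, the family `f` grows at most exponentially, uniformly in time. -/
def ExpGrowth (a : ℝ) (f : ℝ → EuclideanSpace ℝ (Fin n) → ℝ) : Prop :=
  ∃ C A : ℝ, 0 ≤ C ∧ 0 ≤ A ∧ ∀ t, a < t → ∀ x, |f t x| ≤ C * Real.exp (A * ‖x‖)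

namespace ExpGrowth

variable {a : ℝ} {f k : ℝ → EuclideanSpace ℝ (Fin n) → ℝ}

theorem of_bound {C : ℝ} (hf : ∀ t, a < t → ∀ x, |f t x| ≤ C * (1 + ‖x‖)) : ExpGrowth a f := by
  have hC : 0 ≤ C := by
    simpa using (abs_nonneg _).trans (hf (a + 1) (by linarith) 0)
  refine ⟨C, 1, hC, zero_le_one, fun t ht x => (hf t ht x).trans ?_⟩
  gcongr
  linarith [Real.add_one_le_exp (1 * ‖x‖)]

theorem const (c : ℝ) : ExpGrowth a (fun _ (_ : EuclideanSpace ℝ (Fin n)) => c) :=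
  of_bound (C := |c|) fun t _ x => le_mul_of_one_le_right (abs_nonneg c)
    (by linarith [norm_nonneg x])

theorem add (hf : ExpGrowth a f) (hk : ExpGrowth a k) :
    ExpGrowth a fun t x => f t x + k t x := by
  obtain ⟨C, A, hC, hA, h1⟩ := hf
  obtain ⟨C', A', hC', hA', h2⟩ := hk
  refine ⟨C + C', A + A', by positivity, by positivity, fun t ht x => (abs_add_le _ _).trans ?_⟩
  rw [add_mul]
  refine add_le_add ((h1 t ht x).trans ?_) ((h2 t ht x).trans ?_) <;> gcongr <;> linarith

theorem mul (hf : ExpGrowth a f) (hk : ExpGrowth a k) :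
    ExpGrowth a fun t x => f t x * k t x := by
  obtain ⟨C, A, hC, hA, h1⟩ := hf
  obtain ⟨C', A', hC', hA', h2⟩ := hk
  refine ⟨C * C', A + A', by positivity, by positivity, fun t ht x => ?_⟩
  rw [abs_mul, add_mul, Real.exp_add, mul_mul_mul_comm]
  exact mul_le_mul (h1 t ht x) (h2 t ht x) (abs_nonneg _) (by positivity)

theorem neg (hf : ExpGrowth a f) : ExpGrowth a fun t x => -f t x := by
  simpa [ExpGrowth] using hf

theorem sub (hf : ExpGrowth a f) (hk : ExpGrowth a k) :
    ExpGrowth a fun t x => f t x - k t x := by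
  simpa [sub_eq_add_neg] using hf.add hk.neg

theorem pow (hf : ExpGrowth a f) (m : ℕ) : ExpGrowth a fun t x => f t x ^ m := by
  induction m with
  | zero => simpa using const 1
  | succ m ih => simpa [pow_succ] using ih.mul hf

theorem sum {ι : Type*} (s : Finset ι) {f : ι → ℝ → EuclideanSpace ℝ (Fin n) → ℝ}
    (hf : ∀ i, ExpGrowth a (f i)) : ExpGrowth a fun t x => ∑ i ∈ s, f i t x := by
  classical
  induction s using Finset.induction_on with
  | empty => simpa using const 0
  | insert i s hi ih => simpa [Finset.sum_insert hi] using (hf i).add ih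

theorem coord (i : Fin n) : ExpGrowth a fun _ (x : EuclideanSpace ℝ (Fin n)) => x i :=
  of_bound (C := 1) fun t _ x => by
    have := PiLp.norm_apply_le x i
    rw [Real.norm_eq_abs] at this
    linarith

theorem exp_neg (ha : 0 < a) :
    ExpGrowth a fun t (_ : EuclideanSpace ℝ (Fin n)) => Real.exp (-t) :=
  of_bound (C := 1) fun t ht x => by
    have : Real.exp (-t) ≤ 1 := Real.exp_le_one_iff.2 (by linarith)
    rw [abs_of_pos (Real.exp_pos _)]
    linarith [norm_nonneg x]

theorem inv_one_sub_exp (ha : 0 < a) :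
    ExpGrowth a fun t (_ : EuclideanSpace ℝ (Fin n)) => (1 - Real.exp (-2 * t))⁻¹ :=
  of_bound (C := (1 - Real.exp (-2 * a))⁻¹) fun t ht x => by
    have hs := one_sub_exp_neg_pos ha
    have hs' := one_sub_exp_neg_pos (ha.trans ht)
    rw [abs_of_pos (by positivity)]
    refine le_trans ?_ (le_mul_of_one_le_right (by positivity) (by linarith [norm_nonneg x]))
    exact inv_anti₀ hs (by gcongr 1 - Real.exp ?_; linarith)

theorem ouFlow_mul_div (hh : IsDensityInBall R h) (hg : Continuous g) (ha : 0 < a) :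
    ExpGrowth a fun t x => ouFlow (fun y => g y * h y) t x / ouFlow h t x := by
  obtain ⟨B, hB⟩ := (isCompact_closedBall
    (0 : EuclideanSpace ℝ (Fin n)) R).exists_bound_of_continuousOn hg.continuousOn
  refine of_bound (C := |B|) fun t ht x => ?_
  refine (hh.abs_ouFlow_mul_div_le hg (B := |B|) (fun y hy => (hB y (by simpa using hy)).trans
    (le_abs_self B)) (ha.trans ht) x).trans
    (le_mul_of_one_le_right (abs_nonneg B) (by linarith [norm_nonneg x]))

theorem log_ouFlow_div (hh : IsDensityInBall R h) (hg : IsDensityInBall R g) (hR : 0 ≤ R)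
    (ha : 0 < a) : ExpGrowth a fun t x => Real.log (ouFlow h t x / ouFlow g t x) :=
  of_bound (C := 2 * R * (1 + R) / (1 - Real.exp (-2 * a))) fun t ht x => by
    have hs := one_sub_exp_neg_pos ha
    have hsm : 1 - Real.exp (-2 * a) ≤ 1 - Real.exp (-2 * t) := by gcongr 1 - Real.exp ?_; linarith
    calc _ ≤ 2 * (R * (‖x‖ + R) / (1 - Real.exp (-2 * t))) :=
          hh.abs_log_ouFlow_div_le hg (ha.trans ht) x
      _ ≤ 2 * (R * ((1 + R) * (1 + ‖x‖)) / (1 - Real.exp (-2 * a))) := by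
          gcongr
          nlinarith [norm_nonneg x, mul_nonneg hR (norm_nonneg x)]
      _ = _ := by ring

end ExpGrowth

theorem integrable_exp_neg_sq_norm_add (A : ℝ) :
    Integrable fun x : EuclideanSpace ℝ (Fin n) => Real.exp (-‖x‖ ^ 2 / 2 + A * ‖x‖) := by
  have h1 : Integrable fun x : EuclideanSpace ℝ (Fin n) => Real.exp (-‖x‖ ^ 2 / 4) := by
    have := (GaussianFourier.integrable_cexp_neg_mul_sq_norm_add (V := EuclideanSpace ℝ (Fin n))
      (b := 1 / 4) (by norm_num) 0 0).norm
    refine this.congr (ae_of_all _ fun x => ?_)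
    simp only [Complex.norm_exp]
    congr 1
    simp [← Complex.ofReal_pow]
    ring
  refine (h1.const_mul (Real.exp (A ^ 2))).mono' (by fun_prop) (ae_of_all _ fun x => ?_)
  rw [Real.norm_of_nonneg (Real.exp_pos _).le, ← Real.exp_add]
  refine Real.exp_le_exp.2 ?_
  nlinarith [sq_nonneg (A - ‖x‖ / 2)]

theorem IsDensityInBall.exists_integrable_bound (hh : IsDensityInBall R h) (hR : 0 ≤ R) {a : ℝ}
    (ha : 0 < a) {f : ℝ → EuclideanSpace ℝ (Fin n) → ℝ} (hf : ExpGrowth a f) :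
    ∃ b : EuclideanSpace ℝ (Fin n) → ℝ, Integrable b ∧
      ∀ t, a < t → ∀ x, ‖ouFlow h t x * f t x‖ ≤ b x := by
  obtain ⟨C, A, hC, hA, hf⟩ := hf
  have hs := one_sub_exp_neg_pos ha
  set s := 1 - Real.exp (-2 * a) with hsdef
  refine ⟨_, (integrable_exp_neg_sq_norm_add (R / s + A)).const_mul
    ((2 * π * s) ^ (-(n : ℝ) / 2) * Real.exp (R ^ 2 / s) * C), fun t ht x => ?_⟩
  have hsm : s ≤ 1 - Real.exp (-2 * t) := by rw [hsdef]; gcongr 1 - Real.exp ?_; linarith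
  have hst := hs.trans_le hsm
  have hK : ouKernel t x 0 ≤ (2 * π * s) ^ (-(n : ℝ) / 2) * Real.exp (-‖x‖ ^ 2 / 2) := by
    unfold ouKernel
    gcongr ?_ * ?_
    · exact Real.rpow_le_rpow_of_nonpos (by positivity) (by gcongr)
        (div_nonpos_of_nonpos_of_nonneg (by simp) (by norm_num))
    · rw [smul_zero, sub_zero]
      refine Real.exp_le_exp.2 ?_
      rw [neg_div, neg_div, neg_le_neg_iff]
      gcongr
      linarith [Real.exp_pos (-2 * t)]
  have hP := hh.ouFlow_pos (ha.trans ht) x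
  rw [norm_mul, Real.norm_of_nonneg hP.le, Real.norm_eq_abs]
  calc ouFlow h t x * |f t x|
      ≤ ((2 * π * s) ^ (-(n : ℝ) / 2) * Real.exp (-‖x‖ ^ 2 / 2) *
          Real.exp (R * (‖x‖ + R) / s)) * (C * Real.exp (A * ‖x‖)) := by
        gcongr
        · refine (hh.ouFlow_le (ha.trans ht) x).trans ?_
          gcongr
        · exact hf t ht x
    _ = (2 * π * s) ^ (-(n : ℝ) / 2) * C * (Real.exp (-‖x‖ ^ 2 / 2) *
          Real.exp (R * (‖x‖ + R) / s) * Real.exp (A * ‖x‖)) := by ring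
    _ = (2 * π * s) ^ (-(n : ℝ) / 2) * C * (Real.exp (R ^ 2 / s) *
          Real.exp (-‖x‖ ^ 2 / 2 + (R / s + A) * ‖x‖)) := by
        simp only [← Real.exp_add]; congr 2; ring
    _ = _ := by ring

end Bounds

section Entropy

variable {n : ℕ} {R : ℝ} {h g : EuclideanSpace ℝ (Fin n) → ℝ}

/-- The conditional expectation of the `i`-th coordinate of `X₀` given `X_t = x`. -/
def ouMean (h : EuclideanSpace ℝ (Fin n) → ℝ) (i : Fin n) (t : ℝ)
    (x : EuclideanSpace ℝ (Fin n)) : ℝ :=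
  ouFlow (fun y => y i * h y) t x / ouFlow h t x

/-- The conditional expectation of the squared `i`-th coordinate of `X₀` given `X_t = x`. -/
def ouSecondMoment (h : EuclideanSpace ℝ (Fin n) → ℝ) (i : Fin n) (t : ℝ)
    (x : EuclideanSpace ℝ (Fin n)) : ℝ :=
  ouFlow (fun y => y i ^ 2 * h y) t x / ouFlow h t x

/-- The `i`-th partial derivative of `log p_t`. -/
def ouScore (h : EuclideanSpace ℝ (Fin n) → ℝ) (i : Fin n) (t : ℝ)
    (x : EuclideanSpace ℝ (Fin n)) : ℝ :=
  (-(x i) + Real.exp (-t) * ouMean h i t x) / (1 - Real.exp (-2 * t))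

/-- The `i`-th partial derivative of `ouScore h i`. -/
def ouScoreDeriv (h : EuclideanSpace ℝ (Fin n) → ℝ) (i : Fin n) (t : ℝ)
    (x : EuclideanSpace ℝ (Fin n)) : ℝ :=
  (-1 + Real.exp (-t) ^ 2 * (ouSecondMoment h i t x - ouMean h i t x ^ 2)
    / (1 - Real.exp (-2 * t))) / (1 - Real.exp (-2 * t))

/-- The contribution of the `i`-th coordinate to `∂_t log p_t`; by the Fokker–Planck equation it
is `p_t⁻¹ ∂_i (∂_i p_t + x_i p_t)`. -/
def ouLogRate (h : EuclideanSpace ℝ (Fin n) → ℝ) (i : Fin n) (t : ℝ)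
    (x : EuclideanSpace ℝ (Fin n)) : ℝ :=
  ouScoreDeriv h i t x + ouScore h i t x ^ 2 + 1 + x i * ouScore h i t x

/-- The logarithmic density ratio `log (p_t / q_t)`. -/
def ouLogRatio (h g : EuclideanSpace ℝ (Fin n) → ℝ) (t : ℝ)
    (x : EuclideanSpace ℝ (Fin n)) : ℝ :=
  Real.log (ouFlow h t x / ouFlow g t x)

/-- The time derivative of the entropy density `p_t log (p_t / q_t)`. -/
def ouEntropyRate (h g : EuclideanSpace ℝ (Fin n) → ℝ) (t : ℝ)
    (x : EuclideanSpace ℝ (Fin n)) : ℝ :=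
  ∑ i, (ouLogRate h i t x * (ouLogRatio h g t x + 1) - ouLogRate g i t x)

/-- The `i`-th component of the entropy flux divided by `p_t`. -/
def ouFlux (h g : EuclideanSpace ℝ (Fin n) → ℝ) (i : Fin n) (t : ℝ)
    (x : EuclideanSpace ℝ (Fin n)) : ℝ :=
  (ouScore h i t x + x i) * ouLogRatio h g t x + (ouScore h i t x - ouScore g i t x)

/-- The `i`-th partial derivative of the `i`-th component of the entropy flux, divided
by `p_t`. -/
def ouFluxDeriv (h g : EuclideanSpace ℝ (Fin n) → ℝ) (i : Fin n) (t : ℝ)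
    (x : EuclideanSpace ℝ (Fin n)) : ℝ :=
  ouScore h i t x * ouFlux h g i t x
    + ((ouScoreDeriv h i t x + 1) * ouLogRatio h g t x
      + (ouScore h i t x + x i) * (ouScore h i t x - ouScore g i t x)
      + (ouScoreDeriv h i t x - ouScoreDeriv g i t x))

theorem ouEntropyRate_eq (h g : EuclideanSpace ℝ (Fin n) → ℝ) (t : ℝ)
    (x : EuclideanSpace ℝ (Fin n)) :
    ouEntropyRate h g t x =
      ∑ i, (ouFluxDeriv h g i t x - (ouScore h i t x - ouScore g i t x) ^ 2) :=
  Finset.sum_congr rfl fun i _ => by simp only [ouLogRate, ouFluxDeriv, ouFlux]; ring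

theorem IsDensityInBall.exists_hasFDerivAt_log_ouFlow (hh : IsDensityInBall R h) {t : ℝ}
    (ht : 0 < t) (x : EuclideanSpace ℝ (Fin n)) :
    ∃ D : EuclideanSpace ℝ (Fin n) →L[ℝ] ℝ, HasFDerivAt (fun y => Real.log (ouFlow h t y)) D x ∧
      ∀ i, D (EuclideanSpace.single i 1) = ouScore h i t x := by
  obtain ⟨D, hD, hDi⟩ := hh.exists_hasFDerivAt_ouFlow t x
  have hP := (hh.ouFlow_pos ht x).ne'
  refine ⟨_, hD.log hP, fun i => ?_⟩
  rw [smul_apply, hDi, ouScore, ouMean, smul_eq_mul]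
  field_simp

theorem IsDensityInBall.gradient_log_ouFlow_apply (hh : IsDensityInBall R h) {t : ℝ}
    (ht : 0 < t) (x : EuclideanSpace ℝ (Fin n)) (i : Fin n) :
    gradient (fun y => Real.log (ouFlow h t y)) x i = ouScore h i t x := by
  obtain ⟨D, hD, hDi⟩ := hh.exists_hasFDerivAt_log_ouFlow ht x
  have h1 : inner ℝ (gradient (fun y => Real.log (ouFlow h t y)) x) (EuclideanSpace.single i 1)
      = ouScore h i t x := by
    rw [← InnerProductSpace.toDual_apply_apply, toDual_gradient, hD.fderiv, hDi]
  rw [EuclideanSpace.inner_single_right] at h1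
  simpa using h1

theorem IntegrableInBall.hasLineDerivAt_ouFlow (hh : IntegrableInBall R h) (t : ℝ)
    (x : EuclideanSpace ℝ (Fin n)) (i : Fin n) :
    HasLineDerivAt ℝ (ouFlow h t) ((-(x i) * ouFlow h t x
      + Real.exp (-t) * ouFlow (fun y => y i * h y) t x) / (1 - Real.exp (-2 * t))) x
      (EuclideanSpace.single i 1) := by
  obtain ⟨D, hD, hDi⟩ := hh.exists_hasFDerivAt_ouFlow t x
  exact hDi i ▸ hD.hasLineDerivAt _

theorem hasLineDerivAt_coord (x : EuclideanSpace ℝ (Fin n)) (i : Fin n) :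
    HasLineDerivAt ℝ (fun x : EuclideanSpace ℝ (Fin n) => x i) 1 x
      (EuclideanSpace.single i 1) := by
  have := ((EuclideanSpace.proj i : EuclideanSpace ℝ (Fin n) →L[ℝ] ℝ).hasFDerivAt
    (x := x)).hasLineDerivAt (EuclideanSpace.single i 1)
  simpa using this

theorem IsDensityInBall.hasLineDerivAt_ouScore (hh : IsDensityInBall R h) {t : ℝ} (ht : 0 < t)
    (x : EuclideanSpace ℝ (Fin n)) (i : Fin n) :
    HasLineDerivAt ℝ (ouScore h i t) (ouScoreDeriv h i t x) x (EuclideanSpace.single i 1) := by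
  have hP := (hh.ouFlow_pos ht x).ne'
  have hs := (one_sub_exp_neg_pos ht).ne'
  have hi : IntegrableInBall R fun y => y i * h y := hh.mul_left (by fun_prop)
  have h0 : HasDerivAt _ _ _ := hh.hasLineDerivAt_ouFlow t x i
  have h1 : HasDerivAt _ _ _ := hi.hasLineDerivAt_ouFlow t x i
  have hx : HasDerivAt _ _ _ := hasLineDerivAt_coord x i
  have hd := ((hx.neg.add ((h1.div h0 (by simpa using hP)).const_mul
    (Real.exp (-t)))).div_const (1 - Real.exp (-2 * t)))
  refine HasDerivAt.congr_deriv hd ?_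
  have h2 : (fun y : EuclideanSpace ℝ (Fin n) => y i * (y i * h y)) =
    fun y => y i ^ 2 * h y := by ext y; ring
  simp only [ouScoreDeriv, ouMean, ouSecondMoment, zero_smul, add_zero, h2]
  field_simp
  ring

theorem IsDensityInBall.hasLineDerivAt_ouLogRatio (hh : IsDensityInBall R h)
    (hg : IsDensityInBall R g) {t : ℝ} (ht : 0 < t)
    (x : EuclideanSpace ℝ (Fin n)) (i : Fin n) :
    HasLineDerivAt ℝ (ouLogRatio h g t) (ouScore h i t x - ouScore g i t x) x
      (EuclideanSpace.single i 1) := by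
  obtain ⟨D, hD, hDi⟩ := hh.exists_hasFDerivAt_log_ouFlow ht x
  obtain ⟨D', hD', hDi'⟩ := hg.exists_hasFDerivAt_log_ouFlow ht x
  have heq : ouLogRatio h g t = fun y => Real.log (ouFlow h t y) - Real.log (ouFlow g t y) :=
    funext fun y => Real.log_div (hh.ouFlow_pos ht y).ne' (hg.ouFlow_pos ht y).ne'
  rw [heq, ← hDi, ← hDi']
  exact (hD.sub hD').hasLineDerivAt _

theorem IsDensityInBall.hasLineDerivAt_ouFlow_mul_ouFlux (hh : IsDensityInBall R h)
    (hg : IsDensityInBall R g) {t : ℝ} (ht : 0 < t)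
    (x : EuclideanSpace ℝ (Fin n)) (i : Fin n) :
    HasLineDerivAt ℝ (fun x => ouFlow h t x * ouFlux h g i t x)
      (ouFlow h t x * ouFluxDeriv h g i t x) x (EuclideanSpace.single i 1) := by
  have hP := (hh.ouFlow_pos ht x).ne'
  have h0 : HasDerivAt _ _ _ := hh.hasLineDerivAt_ouFlow t x i
  have hx : HasDerivAt _ _ _ := hasLineDerivAt_coord x i
  have h1 : HasDerivAt _ _ _ := hh.hasLineDerivAt_ouScore ht x i
  have h2 : HasDerivAt _ _ _ := hg.hasLineDerivAt_ouScore ht x i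
  have hL : HasDerivAt _ _ _ := hh.hasLineDerivAt_ouLogRatio hg ht x i
  refine (h0.mul (((h1.add hx).mul hL).add (h1.sub h2))).congr_deriv ?_
  have hscore : (-(x i) * ouFlow h t x + Real.exp (-t) * ouFlow (fun y => y i * h y) t x)
      / (1 - Real.exp (-2 * t)) = ouFlow h t x * ouScore h i t x := by
    rw [ouScore, ouMean]; field_simp
  rw [hscore]
  simp only [Pi.add_apply, Pi.mul_apply, Pi.sub_apply, zero_smul, add_zero, ouFluxDeriv, ouFlux]
  ring

theorem IsDensityInBall.hasDerivAt_ouFlow_mul_ouLogRatio (hh : IsDensityInBall R h)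
    (hg : IsDensityInBall R g) {t : ℝ} (ht : 0 < t) (x : EuclideanSpace ℝ (Fin n)) :
    HasDerivAt (fun t => ouFlow h t x * ouLogRatio h g t x)
      (ouFlow h t x * ouEntropyRate h g t x) t := by
  have key : ∀ {f : EuclideanSpace ℝ (Fin n) → ℝ}, IsDensityInBall R f →
      HasDerivAt (fun t => ouFlow f t x) (ouFlow f t x * ∑ i, ouLogRate f i t x) t := by
    intro f hf
    refine (hf.hasDerivAt_ouFlow ht x).congr_deriv ?_
    have hP := (hf.ouFlow_pos ht x).ne'
    have hs := (one_sub_exp_neg_pos ht).ne'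
    have he : Real.exp (-t) ^ 2 = 1 - (1 - Real.exp (-2 * t)) := by rw [exp_neg_two_mul]; ring
    rw [Finset.mul_sum]
    refine Finset.sum_congr rfl fun i _ => ?_
    simp only [ouLogRate, ouScoreDeriv, ouScore, ouMean, ouSecondMoment]
    generalize 1 - Real.exp (-2 * t) = s at *
    generalize Real.exp (-t) = e at *
    obtain rfl : s = 1 - e ^ 2 := by linarith
    field_simp
    ring
  have hP := hh.ouFlow_pos ht x
  have hQ := hg.ouFlow_pos ht x
  refine ((key hh).mul (((key hh).div (key hg) hQ.ne').log (div_pos hP hQ).ne')).congr_deriv ?_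
  simp only [ouEntropyRate, ouLogRatio, Finset.sum_sub_distrib, ← Finset.sum_mul, Pi.div_apply]
  field_simp
  ring

theorem IsDensityInBall.continuous_ouFlow_mul_div (hh : IsDensityInBall R h) (hg : Continuous g)
    {t : ℝ} (ht : 0 < t) :
    Continuous fun x => ouFlow (fun y => g y * h y) t x / ouFlow h t x :=
  ((hh.mul_left hg).continuous_ouFlow t).div (hh.continuous_ouFlow t)
    fun x => (hh.ouFlow_pos ht x).ne'

theorem IsDensityInBall.continuous_ouScore (hh : IsDensityInBall R h) {t : ℝ} (ht : 0 < t)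
    (i : Fin n) : Continuous (ouScore h i t) := by
  have h1 : Continuous (ouMean h i t) := hh.continuous_ouFlow_mul_div (by fun_prop) ht
  unfold ouScore
  fun_prop

theorem IsDensityInBall.continuous_ouScoreDeriv (hh : IsDensityInBall R h) {t : ℝ} (ht : 0 < t)
    (i : Fin n) : Continuous (ouScoreDeriv h i t) := by
  have h1 : Continuous (ouMean h i t) := hh.continuous_ouFlow_mul_div (by fun_prop) ht
  have h2 : Continuous (ouSecondMoment h i t) := hh.continuous_ouFlow_mul_div (by fun_prop) ht
  unfold ouScoreDeriv
  fun_prop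

theorem IsDensityInBall.continuous_ouLogRatio (hh : IsDensityInBall R h)
    (hg : IsDensityInBall R g) {t : ℝ} (ht : 0 < t) : Continuous (ouLogRatio h g t) :=
  ((hh.continuous_ouFlow t).div (hg.continuous_ouFlow t) fun x => (hg.ouFlow_pos ht x).ne').log
    fun x => (div_pos (hh.ouFlow_pos ht x) (hg.ouFlow_pos ht x)).ne'

theorem IsDensityInBall.expGrowth_ouScore (hh : IsDensityInBall R h) {a : ℝ} (ha : 0 < a)
    (i : Fin n) : ExpGrowth a (ouScore h i) := by
  have hm : ExpGrowth a (ouMean h i) := ExpGrowth.ouFlow_mul_div hh (by fun_prop) ha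
  exact ((ExpGrowth.coord i).neg.add ((ExpGrowth.exp_neg ha).mul hm)).mul
    (ExpGrowth.inv_one_sub_exp ha)

theorem IsDensityInBall.expGrowth_ouScoreDeriv (hh : IsDensityInBall R h) {a : ℝ} (ha : 0 < a)
    (i : Fin n) : ExpGrowth a (ouScoreDeriv h i) := by
  have hm : ExpGrowth a (ouMean h i) := ExpGrowth.ouFlow_mul_div hh (by fun_prop) ha
  have hm2 : ExpGrowth a (ouSecondMoment h i) := ExpGrowth.ouFlow_mul_div hh (by fun_prop) ha
  exact ((ExpGrowth.const (-1)).add ((((ExpGrowth.exp_neg ha).pow 2).mul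
    (hm2.sub (hm.pow 2))).mul (ExpGrowth.inv_one_sub_exp ha))).mul (ExpGrowth.inv_one_sub_exp ha)

theorem IsDensityInBall.integrable_ouFlow_mul (hh : IsDensityInBall R h) (hR : 0 ≤ R) {a : ℝ}
    (ha : 0 < a) {f : ℝ → EuclideanSpace ℝ (Fin n) → ℝ} (hf : ExpGrowth a f) {t : ℝ}
    (hat : a < t) (hc : Continuous (f t)) : Integrable fun x => ouFlow h t x * f t x := by
  obtain ⟨b, hb, hbound⟩ := hh.exists_integrable_bound hR ha hf
  exact hb.mono' ((hh.continuous_ouFlow t).mul hc).aestronglyMeasurable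
    (ae_of_all _ (hbound t hat))

theorem integral_hasLineDerivAt_eq_zero {f f' : EuclideanSpace ℝ (Fin n) → ℝ}
    {v : EuclideanSpace ℝ (Fin n)} (hf : Integrable f) (hf' : Integrable f')
    (hd : ∀ x, HasLineDerivAt ℝ f (f' x) x v) : ∫ x, f' x = 0 := by
  have := integral_bilinear_hasLineDerivAt_right_eq_neg_left_of_integrable (μ := volume)
    (f := f) (f' := f') (g := fun _ : EuclideanSpace ℝ (Fin n) => (1 : ℝ)) (g' := fun _ => 0)
    (v := v) (B := ContinuousLinearMap.mul ℝ ℝ) (by simpa using hf') (by simp) (by simpa using hf)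
    (fun x _ => hd x) (fun x _ => by simpa [HasLineDerivAt] using hasDerivAt_const (0 : ℝ) (1 : ℝ))
  simpa using this.symm

theorem IsDensityInBall.hasDerivAt_integral_ouFlow_mul_ouLogRatio (hh : IsDensityInBall R h)
    (hg : IsDensityInBall R g) (hR : 0 ≤ R) {t : ℝ} (ht : 0 < t) :
    HasDerivAt (fun τ => ∫ x, ouFlow h τ x * ouLogRatio h g τ x)
      (-∫ x, ouFlow h t x * ∑ i, (ouScore h i t x - ouScore g i t x) ^ 2) t := by
  obtain ⟨a, ha, hat⟩ := exists_between ht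
  have hL : ExpGrowth a (ouLogRatio h g) := ExpGrowth.log_ouFlow_div hh hg hR ha
  have gs := fun i => hh.expGrowth_ouScore ha i
  have gs' := fun i => hg.expGrowth_ouScore ha i
  have gd := fun i => hh.expGrowth_ouScoreDeriv ha i
  have gd' := fun i => hg.expGrowth_ouScoreDeriv ha i
  have hx := fun i : Fin n => ExpGrowth.coord (a := a) i
  have one := ExpGrowth.const (n := n) (a := a) 1
  have gflux (i : Fin n) : ExpGrowth a (ouFlux h g i) :=
    (((gs i).add (hx i)).mul hL).add ((gs i).sub (gs' i))
  have gfluxD (i : Fin n) : ExpGrowth a (ouFluxDeriv h g i) :=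
    ((gs i).mul (gflux i)).add ((((gd i).add one).mul hL).add
      (((gs i).add (hx i)).mul ((gs i).sub (gs' i))) |>.add ((gd i).sub (gd' i)))
  have gsq (i : Fin n) : ExpGrowth a fun t x => (ouScore h i t x - ouScore g i t x) ^ 2 :=
    ((gs i).sub (gs' i)).pow 2
  have grate : ExpGrowth a (ouEntropyRate h g) := by
    have := ExpGrowth.sum Finset.univ fun i => (gfluxD i).sub (gsq i)
    simpa only [← ouEntropyRate_eq] using this
  have cL := hh.continuous_ouLogRatio hg ht
  have cs := fun i => hh.continuous_ouScore ht i
  have cs' := fun i => hg.continuous_ouScore ht i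
  have cd := fun i => hh.continuous_ouScoreDeriv ht i
  have cd' := fun i => hg.continuous_ouScoreDeriv ht i
  have cflux (i : Fin n) : Continuous (ouFlux h g i t) := by unfold ouFlux; fun_prop
  have cfluxD (i : Fin n) : Continuous (ouFluxDeriv h g i t) := by unfold ouFluxDeriv; fun_prop
  have crate : Continuous (ouEntropyRate h g t) := by
    rw [show ouEntropyRate h g t = _ from funext (ouEntropyRate_eq h g t)]
    fun_prop
  obtain ⟨b, hb, hbound⟩ := hh.exists_integrable_bound hR ha grate
  have hderiv := (hasDerivAt_integral_of_dominated_loc_of_deriv_le (μ := volume)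
    (F := fun τ x => ouFlow h τ x * ouLogRatio h g τ x)
    (F' := fun τ x => ouFlow h τ x * ouEntropyRate h g τ x) (bound := b) (Ioi_mem_nhds hat)
    (by
      filter_upwards [Ioi_mem_nhds ht] with τ hτ
      exact ((hh.continuous_ouFlow τ).mul
        (hh.continuous_ouLogRatio hg hτ)).aestronglyMeasurable)
    (hh.integrable_ouFlow_mul hR ha hL hat cL)
    ((hh.continuous_ouFlow t).mul crate).aestronglyMeasurable
    (ae_of_all _ fun x τ hτ => hbound τ hτ x) hb
    (ae_of_all _ fun x τ hτ => hh.hasDerivAt_ouFlow_mul_ouLogRatio hg (ha.trans hτ) x)).2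
  refine hderiv.congr_deriv ?_
  have iflux (i : Fin n) := hh.integrable_ouFlow_mul hR ha (gflux i) hat (cflux i)
  have ifluxD (i : Fin n) := hh.integrable_ouFlow_mul hR ha (gfluxD i) hat (cfluxD i)
  have isq := hh.integrable_ouFlow_mul hR ha (ExpGrowth.sum Finset.univ gsq) hat (by fun_prop)
  have hzero (i : Fin n) : ∫ x, ouFlow h t x * ouFluxDeriv h g i t x = 0 :=
    integral_hasLineDerivAt_eq_zero (iflux i) (ifluxD i)
      fun x => hh.hasLineDerivAt_ouFlow_mul_ouFlux hg ht x i
  calc ∫ x, ouFlow h t x * ouEntropyRate h g t x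
      = ∫ x, (∑ i, ouFlow h t x * ouFluxDeriv h g i t x
          - ouFlow h t x * ∑ i, (ouScore h i t x - ouScore g i t x) ^ 2) := by
        congr 1 with x
        rw [ouEntropyRate_eq, Finset.sum_sub_distrib, mul_sub, Finset.mul_sum]
    _ = _ := by
        rw [integral_sub (integrable_finsetSum _ fun i _ => ifluxD i) isq,
          integral_finsetSum _ fun i _ => ifluxD i]
        simp [hzero]

end Entropy

/-- de Bruijn-type identity for the Ornstein–Uhlenbeck process
(the OU case of the paper's Theorem 11): along the OU marginals `p_t, q_t` of two
initial densities supported in the closed ball of radius `R`, the map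
`t ↦ KL(p_t ‖ q_t)` is differentiable on `(0,∞)` with derivative `-I(p_t ‖ q_t)`,
the negative relative Fisher information. -/
theorem ou_kl_derivative_eq_neg_fisher
    (n : ℕ) (hn : 0 < n) (R : ℝ) (hR : 0 < R)
    (p₀ q₀ : EuclideanSpace ℝ (Fin n) → ℝ)
    (hp₀nonneg : ∀ x, 0 ≤ p₀ x) (hq₀nonneg : ∀ x, 0 ≤ q₀ x)
    (hp₀int : Integrable p₀) (hq₀int : Integrable q₀)
    (hp₀one : ∫ x, p₀ x = 1) (hq₀one : ∫ x, q₀ x = 1)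
    (hp₀supp : ∀ x, x ∉ Metric.closedBall (0 : EuclideanSpace ℝ (Fin n)) R → p₀ x = 0)
    (hq₀supp : ∀ x, x ∉ Metric.closedBall (0 : EuclideanSpace ℝ (Fin n)) R → q₀ x = 0)
    (p q : ℝ → EuclideanSpace ℝ (Fin n) → ℝ)
    (hp : ∀ t x, p t x =
      ∫ x₀, (2 * π * (1 - Real.exp (-2 * t))) ^ (-(n : ℝ) / 2) *
        Real.exp (-‖x - Real.exp (-t) • x₀‖ ^ 2 / (2 * (1 - Real.exp (-2 * t)))) * p₀ x₀)
    (hq : ∀ t x, q t x =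
      ∫ x₀, (2 * π * (1 - Real.exp (-2 * t))) ^ (-(n : ℝ) / 2) *
        Real.exp (-‖x - Real.exp (-t) • x₀‖ ^ 2 / (2 * (1 - Real.exp (-2 * t)))) * q₀ x₀) :
    DifferentiableOn ℝ
        (fun t => ∫ x, p t x * Real.log (p t x / q t x)) (Set.Ioi (0 : ℝ)) ∧
      ∀ t : ℝ, 0 < t →
        HasDerivAt (fun τ => ∫ x, p τ x * Real.log (p τ x / q τ x))
          (-∫ x, p t x *
            ‖gradient (fun y => Real.log (p t y)) x
              - gradient (fun y => Real.log (q t y)) x‖ ^ 2) t := by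
  obtain rfl : p = ouFlow p₀ := funext fun t => funext fun x => hp t x
  obtain rfl : q = ouFlow q₀ := funext fun t => funext fun x => hq t x
  have dp : IsDensityInBall R p₀ := ⟨⟨hp₀int, hp₀supp⟩, hp₀nonneg, hp₀one⟩
  have dq : IsDensityInBall R q₀ := ⟨⟨hq₀int, hq₀supp⟩, hq₀nonneg, hq₀one⟩
  have hderiv : ∀ t : ℝ, 0 < t →
      HasDerivAt (fun τ => ∫ x, ouFlow p₀ τ x * Real.log (ouFlow p₀ τ x / ouFlow q₀ τ x))
        (-∫ x, ouFlow p₀ t x *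
          ‖gradient (fun y => Real.log (ouFlow p₀ t y)) x
            - gradient (fun y => Real.log (ouFlow q₀ t y)) x‖ ^ 2) t := by
    intro t ht
    simpa only [EuclideanSpace.real_norm_sq_eq, PiLp.sub_apply, ouLogRatio,
      dp.gradient_log_ouFlow_apply ht, dq.gradient_log_ouFlow_apply ht] using
      dp.hasDerivAt_integral_ouFlow_mul_ouLogRatio dq hR.le ht
  exact ⟨fun t ht => (hderiv t ht).differentiableAt.differentiableWithinAt, hderiv⟩
end
end

section
/- Let n be a positive natural number, R > 0 and t > 0, and write s_t = 1 - e^{-2t}. Let p₀ and q₀ be probability density functions on ℝⁿ that vanish outside the closed ball of radius R centered at the origin, and define p_t(x) = ∫_{ℝⁿ} (2π s_t)^{-n/2} · exp( -‖x - e^{-t}x₀‖²/(2 s_t) ) · p₀(x₀) dx₀ and q_t analogously with q₀ in place of p₀. Then the Kullback–Leibler divergence satisfies KL(p_t ‖ q_t) = ∫_{ℝⁿ} p_t(x) · log( p_t(x)/q_t(x) ) dx ≤ 2R² · e^{-2t}/(1 - e^{-2t}). -/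
open MeasureTheory Real
open scoped BigOperators

noncomputable section

/-- The log-sum inequality: `(∫ f) log (∫ f / ∫ g) ≤ ∫ f log (f / g)`. -/
theorem integral_mul_log_div_le {Ω : Type*} [MeasurableSpace Ω] {μ : Measure Ω} {f g : Ω → ℝ}
    (hf : ∀ x, 0 < f x) (hg : ∀ x, 0 < g x) (hfi : Integrable f μ) (hgi : Integrable g μ)
    (hfg : Integrable (fun x ↦ f x * log (f x / g x)) μ)
    (hF : 0 < ∫ x, f x ∂μ) (hG : 0 < ∫ x, g x ∂μ) :
    (∫ x, f x ∂μ) * log ((∫ x, f x ∂μ) / ∫ x, g x ∂μ) ≤ ∫ x, f x * log (f x / g x) ∂μ := by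
  set F := ∫ x, f x ∂μ with hFdef
  set G := ∫ x, g x ∂μ with hGdef
  have tangent : ∀ x, f x * log (F / G) + (f x - g x * (F / G)) ≤ f x * log (f x / g x) := by
    intro x
    have hfx := hf x
    have hgx := hg x
    have h := log_le_sub_one_of_pos (show 0 < g x * F / (f x * G) by positivity)
    have hlog : log (g x * F / (f x * G)) = log (F / G) - log (f x / g x) := by
      rw [log_div (by positivity) (by positivity), log_mul hgx.ne' hF.ne',
        log_mul hfx.ne' hG.ne', log_div hF.ne' hG.ne', log_div hfx.ne' hgx.ne']
      ring
    rw [hlog] at h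
    have hmul := mul_le_mul_of_nonneg_left h hfx.le
    have hcancel : f x * (g x * F / (f x * G) - 1) = g x * (F / G) - f x := by
      field_simp
    rw [hcancel] at hmul
    linarith
  have h := integral_mono ((hfi.mul_const (log (F / G))).add (hfi.sub (hgi.mul_const (F / G))))
    hfg tangent
  rw [integral_add' (hfi.mul_const _) (hfi.sub (hgi.mul_const _)),
    integral_sub' hfi (hgi.mul_const _), integral_mul_const, integral_mul_const,
    ← hFdef, ← hGdef, mul_div_cancel₀ _ hG.ne', sub_self, add_zero] at h
  exact h

theorem exp_neg_mul_sq_norm_sub_mul_le {V : Type*} [NormedAddCommGroup V] {b r : ℝ} (hb : 0 < b)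
    {a c : V} (ha : ‖a‖ ≤ r) (hc : ‖c‖ ≤ r) (x : V) :
    ‖exp (-b * ‖x - a‖ ^ 2) * (b * (‖x - c‖ ^ 2 - ‖x - a‖ ^ 2))‖
      ≤ 8 * exp (5 / 4 * b * r ^ 2) * exp (-(b / 4) * ‖x‖ ^ 2) := by
  have hr : 0 ≤ r := (norm_nonneg a).trans ha
  have hupper : ∀ y : V, ‖y‖ ≤ r → ‖x - y‖ ^ 2 ≤ 2 * ‖x‖ ^ 2 + 2 * r ^ 2 := by
    intro y hy
    have := norm_sub_le x y
    nlinarith [sq_nonneg (‖x‖ - r), norm_nonneg (x - y), norm_nonneg x]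
  have hlower : ‖x‖ ^ 2 / 2 - r ^ 2 ≤ ‖x - a‖ ^ 2 := by
    have : ‖x‖ ≤ ‖x - a‖ + ‖a‖ := by simpa using norm_add_le (x - a) a
    nlinarith [sq_nonneg (‖x - a‖ - r), norm_nonneg (x - a), norm_nonneg x]
  have hexp : exp (-b * ‖x - a‖ ^ 2) ≤ exp (-b * (‖x‖ ^ 2 / 2 - r ^ 2)) := by
    apply exp_le_exp.2
    nlinarith
  have hdiff : |b * (‖x - c‖ ^ 2 - ‖x - a‖ ^ 2)| ≤ 8 * exp (b / 4 * (‖x‖ ^ 2 + r ^ 2)) := by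
    have habs : |‖x - c‖ ^ 2 - ‖x - a‖ ^ 2| ≤ 2 * ‖x‖ ^ 2 + 2 * r ^ 2 := by
      rw [abs_le]
      constructor <;> nlinarith [hupper a ha, hupper c hc, sq_nonneg ‖x - a‖, sq_nonneg ‖x - c‖]
    rw [abs_mul, abs_of_pos hb]
    nlinarith [add_one_le_exp (b / 4 * (‖x‖ ^ 2 + r ^ 2))]
  rw [norm_mul, norm_of_nonneg (exp_pos _).le, Real.norm_eq_abs]
  calc _ ≤ exp (-b * (‖x‖ ^ 2 / 2 - r ^ 2)) * (8 * exp (b / 4 * (‖x‖ ^ 2 + r ^ 2))) := by gcongr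
    _ = _ := by
      rw [mul_left_comm, mul_assoc, ← exp_add, ← exp_add]
      ring_nf

section Gaussian

variable {V : Type*} [NormedAddCommGroup V] [InnerProductSpace ℝ V] [FiniteDimensional ℝ V]
  [MeasurableSpace V] [BorelSpace V]

theorem integrable_exp_neg_mul_sq_norm {b : ℝ} (hb : 0 < b) :
    Integrable fun x : V ↦ exp (-b * ‖x‖ ^ 2) := by
  refine .of_integral_ne_zero ?_
  rw [GaussianFourier.integral_rexp_neg_mul_sq_norm hb]
  positivity

theorem integral_exp_neg_mul_sq_norm_mul_inner (b : ℝ) (v : V) :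
    ∫ x : V, exp (-b * ‖x‖ ^ 2) * inner ℝ x v = 0 := by
  have h := integral_neg_eq_self (fun x : V ↦ exp (-b * ‖x‖ ^ 2) * inner ℝ x v) volume
  simp only [norm_neg, inner_neg_left, mul_neg, integral_neg] at h
  linarith

theorem integral_exp_neg_mul_sq_norm_sub_mul {b : ℝ} (hb : 0 < b) (a c : V) :
    ∫ x : V, exp (-b * ‖x - a‖ ^ 2) * (b * (‖x - c‖ ^ 2 - ‖x - a‖ ^ 2))
      = b * ‖a - c‖ ^ 2 * ∫ x : V, exp (-b * ‖x‖ ^ 2) := by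
  have hint : Integrable fun x : V ↦
      exp (-b * ‖x‖ ^ 2) * (b * (‖x + (a - c)‖ ^ 2 - ‖x‖ ^ 2)) := by
    refine ((integrable_exp_neg_mul_sq_norm (V := V) (show 0 < b / 4 by positivity)).const_mul
      (8 * exp (5 / 4 * b * ‖a - c‖ ^ 2))).mono' (by fun_prop) (.of_forall fun x ↦ ?_)
    rw [show x + (a - c) = x - (c - a) by abel]
    simpa using exp_neg_mul_sq_norm_sub_mul_le hb (a := (0 : V)) (c := c - a)
      (r := ‖a - c‖) (by simp) (norm_sub_rev c a).le x
  have hsplit : ∀ x : V, exp (-b * ‖x‖ ^ 2) * (b * (‖x + (a - c)‖ ^ 2 - ‖x‖ ^ 2))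
      = 2 * b * (exp (-b * ‖x‖ ^ 2) * inner ℝ x (a - c))
        + b * ‖a - c‖ ^ 2 * exp (-b * ‖x‖ ^ 2) := by
    intro x
    rw [norm_add_sq_real]
    ring
  have hgauss := (integrable_exp_neg_mul_sq_norm (V := V) hb).const_mul (b * ‖a - c‖ ^ 2)
  have hinner : Integrable fun x : V ↦ 2 * b * (exp (-b * ‖x‖ ^ 2) * inner ℝ x (a - c)) := by
    refine (hint.sub hgauss).congr (.of_forall fun x ↦ ?_)
    simp only [Pi.sub_apply, hsplit x, add_sub_cancel_right]
  rw [← integral_add_right_eq_self _ a]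
  simp only [add_sub_cancel_right, add_sub_assoc]
  simp_rw [hsplit]
  rw [integral_add hinner hgauss, integral_const_mul, integral_const_mul,
    integral_exp_neg_mul_sq_norm_mul_inner, mul_zero, zero_add]

/-- Two mixtures of the Gaussian `C exp (-b ‖x‖²)` with centers in the ball of radius `r`
have Kullback–Leibler divergence at most `4 b r²`. -/
theorem integral_gaussian_mixture_mul_log_div_le {b C r : ℝ} (hb : 0 < b) (hC : 0 < C)
    (hone : C * ∫ x : V, exp (-b * ‖x‖ ^ 2) = 1)
    (μ ν : Measure V) [IsProbabilityMeasure μ] [IsProbabilityMeasure ν]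
    (hμ : ∀ᵐ a ∂μ, ‖a‖ ≤ r) (hν : ∀ᵐ a ∂ν, ‖a‖ ≤ r) :
    ∫ x : V, (∫ a, C * exp (-b * ‖x - a‖ ^ 2) ∂μ) *
        log ((∫ a, C * exp (-b * ‖x - a‖ ^ 2) ∂μ) / ∫ a, C * exp (-b * ‖x - a‖ ^ 2) ∂ν)
      ≤ 4 * b * r ^ 2 := by
  set k : V → ℝ := fun x ↦ C * exp (-b * ‖x‖ ^ 2) with hk
  have hkpos : ∀ x, 0 < k x := fun x ↦ by positivity
  have hkcont : Continuous k := by fun_prop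
  have hkle : ∀ x, ‖k x‖ ≤ C := fun x ↦ by
    rw [norm_of_nonneg (hkpos x).le]
    exact mul_le_of_le_one_right hC.le (exp_le_one_iff.2 (by nlinarith [sq_nonneg ‖x‖]))
  have hkint : ∀ (ρ : Measure V) [IsProbabilityMeasure ρ] (x : V),
      Integrable (fun a ↦ k (x - a)) ρ := fun ρ _ x ↦
    .of_bound (by fun_prop) C (.of_forall fun a ↦ hkle _)
  have hmixpos : ∀ (ρ : Measure V) [IsProbabilityMeasure ρ] (x : V),
      0 < ∫ a, k (x - a) ∂ρ := fun ρ _ x ↦ by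
    rw [integral_pos_iff_support_of_nonneg (fun a ↦ (hkpos _).le) (hkint ρ x)]
    simp [Function.support_eq_univ fun a ↦ (hkpos (x - a)).ne']
  let F : V × V → V → ℝ := fun z x ↦
    C * (exp (-b * ‖x - z.1‖ ^ 2) * (b * (‖x - z.2‖ ^ 2 - ‖x - z.1‖ ^ 2)))
  have hF : ∀ z x, k (x - z.1) * log (k (x - z.1) / k (x - z.2)) = F z x := by
    intro z x
    have hlog : log (k (x - z.1) / k (x - z.2)) = b * (‖x - z.2‖ ^ 2 - ‖x - z.1‖ ^ 2) := by
      simp only [hk]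
      rw [mul_div_mul_left _ _ hC.ne', ← exp_sub, log_exp]
      ring
    rw [hlog]
    simp only [hk, F]
    ring
  let G : V → ℝ := fun x ↦ C * (8 * exp (5 / 4 * b * r ^ 2) * exp (-(b / 4) * ‖x‖ ^ 2))
  have hGint : Integrable G :=
    ((integrable_exp_neg_mul_sq_norm (by positivity)).const_mul _).const_mul _
  have hball : ∀ᵐ z ∂μ.prod ν, ‖z.1‖ ≤ r ∧ ‖z.2‖ ≤ r :=
    (Measure.quasiMeasurePreserving_fst.ae hμ).and (Measure.quasiMeasurePreserving_snd.ae hν)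
  have hFG : ∀ z : V × V, ‖z.1‖ ≤ r ∧ ‖z.2‖ ≤ r → ∀ x, ‖F z x‖ ≤ G x := by
    intro z hz x
    simp only [F, G]
    rw [norm_mul, norm_of_nonneg hC.le]
    exact mul_le_mul_of_nonneg_left (exp_neg_mul_sq_norm_sub_mul_le hb hz.1 hz.2 x) hC.le
  have hFint : Integrable (Function.uncurry F) ((μ.prod ν).prod volume) := by
    refine (hGint.comp_snd (μ.prod ν)).mono' ?_ ?_
    · refine Continuous.aestronglyMeasurable ?_
      simp only [Function.uncurry_def, F]
      fun_prop
    · filter_upwards [Measure.quasiMeasurePreserving_fst.ae hball] with w hw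
      exact hFG w.1 hw w.2
  have hpointwise : ∀ x, (∫ a, k (x - a) ∂μ) * log ((∫ a, k (x - a) ∂μ) / ∫ a, k (x - a) ∂ν)
      ≤ ∫ z, F z x ∂μ.prod ν := by
    intro x
    have hfst : ∫ z, k (x - z.1) ∂μ.prod ν = ∫ a, k (x - a) ∂μ := by
      simpa using integral_fun_fst (μ := μ) (ν := ν) fun a ↦ k (x - a)
    have hsnd : ∫ z, k (x - z.2) ∂μ.prod ν = ∫ a, k (x - a) ∂ν := by
      simpa using integral_fun_snd (μ := μ) (ν := ν) fun a ↦ k (x - a)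
    have h := integral_mul_log_div_le (μ := μ.prod ν) (f := fun z ↦ k (x - z.1))
      (g := fun z ↦ k (x - z.2)) (fun _ ↦ hkpos _) (fun _ ↦ hkpos _)
      ((hkint μ x).comp_fst ν) ((hkint ν x).comp_snd μ)
      (by
        simp_rw [hF]
        refine .of_bound (Continuous.aestronglyMeasurable (by simp only [F]; fun_prop)) (G x) ?_
        filter_upwards [hball] with z hz using hFG z hz x)
      (hfst ▸ hmixpos μ x) (hsnd ▸ hmixpos ν x)
    simp_rw [hF] at h
    rwa [hfst, hsnd] at h
  have hinner : ∀ z, ∫ x, F z x = b * ‖z.1 - z.2‖ ^ 2 := by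
    intro z
    simp only [F]
    rw [integral_const_mul, integral_exp_neg_mul_sq_norm_sub_mul hb, mul_left_comm, hone, mul_one]
  have hbound : ∫ x, ∫ z, F z x ∂μ.prod ν ≤ 4 * b * r ^ 2 := by
    rw [← integral_integral_swap hFint]
    have hle : ∀ᵐ z ∂μ.prod ν, ∫ x, F z x ≤ 4 * b * r ^ 2 := by
      filter_upwards [hball] with z hz
      have hsub : ‖z.1 - z.2‖ ≤ 2 * r := by linarith [norm_sub_le z.1 z.2, hz.1, hz.2]
      rw [hinner]
      nlinarith [pow_le_pow_left₀ (norm_nonneg _) hsub 2]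
    simpa using integral_mono_ae hFint.integral_prod_left (integrable_const _) hle
  by_cases hint : Integrable fun x ↦
      (∫ a, k (x - a) ∂μ) * log ((∫ a, k (x - a) ∂μ) / ∫ a, k (x - a) ∂ν)
  · exact (integral_mono hint hFint.integral_prod_right hpointwise).trans hbound
  · rw [integral_undef hint]
    positivity

/-- A probability density supported in a ball, pushed forward by a scaling, as a measure. -/
theorem exists_probabilityMeasure_integral_eq_of_density {f : V → ℝ} (hf : ∀ x, 0 ≤ f x)
    (hfi : Integrable f) (hone : ∫ x, f x = 1) {R c : ℝ} (hc : 0 ≤ c)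
    (hsupp : ∀ x, x ∉ Metric.closedBall (0 : V) R → f x = 0) :
    ∃ μ : Measure V, IsProbabilityMeasure μ ∧ (∀ᵐ a ∂μ, ‖a‖ ≤ c * R) ∧
      ∀ g : V → ℝ, Continuous g → ∫ a, g a ∂μ = ∫ x, g (c • x) * f x := by
  have hmeas : AEMeasurable (fun x ↦ ENNReal.ofReal (f x)) := hfi.aemeasurable.ennreal_ofReal
  have hprob : IsProbabilityMeasure (volume.withDensity fun x ↦ ENNReal.ofReal (f x)) := by
    constructor
    rw [withDensity_apply _ MeasurableSet.univ, Measure.restrict_univ,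
      ← ofReal_integral_eq_lintegral_ofReal hfi (.of_forall hf), hone, ENNReal.ofReal_one]
  have hscale : Continuous fun x : V ↦ c • x := by fun_prop
  refine ⟨(volume.withDensity fun x ↦ ENNReal.ofReal (f x)).map fun x ↦ c • x,
    Measure.isProbabilityMeasure_map hscale.aemeasurable, ?_, fun g hg ↦ ?_⟩
  · rw [ae_map_iff hscale.aemeasurable (measurableSet_le (by fun_prop) (by fun_prop)),
      ae_withDensity_iff' hmeas]
    refine .of_forall fun x hx ↦ ?_
    have hxR : ‖x‖ ≤ R := by
      by_contra hlt
      exact hx (by simp [hsupp x (by simpa using hlt)])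
    rw [norm_smul, norm_of_nonneg hc]
    gcongr
  · rw [integral_map hscale.aemeasurable hg.aestronglyMeasurable,
      integral_withDensity_eq_integral_toReal_smul₀ hmeas (.of_forall fun _ ↦ ENNReal.ofReal_lt_top)]
    refine integral_congr_ae (.of_forall fun x ↦ ?_)
    simp [ENNReal.toReal_ofReal (hf x), mul_comm]

end Gaussian

/-- KL bound for the Ornstein–Uhlenbeck SDE (paper's Theorem 13):
for the OU marginals `p_t, q_t` of two initial densities supported in the closed
ball of radius `R`, `KL(p_t ‖ q_t) = ∫ p_t log(p_t/q_t) ≤ 2R² e^{-2t}/(1 - e^{-2t})`. -/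
theorem ou_kl_bound
    (n : ℕ) (hn : 0 < n) (R t : ℝ) (hR : 0 < R) (ht : 0 < t)
    (p₀ q₀ : EuclideanSpace ℝ (Fin n) → ℝ)
    (hp₀nonneg : ∀ x, 0 ≤ p₀ x) (hq₀nonneg : ∀ x, 0 ≤ q₀ x)
    (hp₀int : Integrable p₀) (hq₀int : Integrable q₀)
    (hp₀one : ∫ x, p₀ x = 1) (hq₀one : ∫ x, q₀ x = 1)
    (hp₀supp : ∀ x, x ∉ Metric.closedBall (0 : EuclideanSpace ℝ (Fin n)) R → p₀ x = 0)
    (hq₀supp : ∀ x, x ∉ Metric.closedBall (0 : EuclideanSpace ℝ (Fin n)) R → q₀ x = 0)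
    (pt qt : EuclideanSpace ℝ (Fin n) → ℝ)
    (hpt : ∀ x, pt x =
      ∫ x₀, (2 * π * (1 - Real.exp (-2 * t))) ^ (-(n : ℝ) / 2) *
        Real.exp (-‖x - Real.exp (-t) • x₀‖ ^ 2 / (2 * (1 - Real.exp (-2 * t)))) * p₀ x₀)
    (hqt : ∀ x, qt x =
      ∫ x₀, (2 * π * (1 - Real.exp (-2 * t))) ^ (-(n : ℝ) / 2) *
        Real.exp (-‖x - Real.exp (-t) • x₀‖ ^ 2 / (2 * (1 - Real.exp (-2 * t)))) * q₀ x₀) :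
    (∫ x, pt x * Real.log (pt x / qt x))
      ≤ 2 * R ^ 2 * Real.exp (-2 * t) / (1 - Real.exp (-2 * t)) := by
  have hs : 0 < 1 - Real.exp (-2 * t) := by
    have : Real.exp (-2 * t) < 1 := exp_lt_one_iff.2 (by linarith)
    linarith
  set s := 1 - Real.exp (-2 * t) with hsdef
  set C := (2 * π * s) ^ (-(n : ℝ) / 2) with hCdef
  have hb : 0 < 1 / (2 * s) := by positivity
  have hC : 0 < C := by positivity
  have hone : C * ∫ x : EuclideanSpace ℝ (Fin n), Real.exp (-(1 / (2 * s)) * ‖x‖ ^ 2) = 1 := by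
    rw [GaussianFourier.integral_rexp_neg_mul_sq_norm hb, finrank_euclideanSpace_fin, hCdef,
      show π / (1 / (2 * s)) = 2 * π * s by field_simp, ← rpow_add (by positivity)]
    ring_nf
    simp
  obtain ⟨μ, hμprob, hμ, hμint⟩ := exists_probabilityMeasure_integral_eq_of_density hp₀nonneg
    hp₀int hp₀one (exp_pos (-t)).le hp₀supp
  obtain ⟨ν, hνprob, hν, hνint⟩ := exists_probabilityMeasure_integral_eq_of_density hq₀nonneg
    hq₀int hq₀one (exp_pos (-t)).le hq₀supp
  have hexponent : ∀ x a : EuclideanSpace ℝ (Fin n),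
      -‖x - a‖ ^ 2 / (2 * s) = -(1 / (2 * s)) * ‖x - a‖ ^ 2 := fun x a ↦ by ring
  have hpt' : ∀ x, pt x = ∫ a, C * Real.exp (-(1 / (2 * s)) * ‖x - a‖ ^ 2) ∂μ := fun x ↦ by
    rw [hμint _ (by fun_prop), hpt]
    simp_rw [hexponent]
  have hqt' : ∀ x, qt x = ∫ a, C * Real.exp (-(1 / (2 * s)) * ‖x - a‖ ^ 2) ∂ν := fun x ↦ by
    rw [hνint _ (by fun_prop), hqt]
    simp_rw [hexponent]
  simp_rw [hpt', hqt']
  refine (integral_gaussian_mixture_mul_log_div_le hb hC hone μ ν hμ hν).trans_eq ?_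
  rw [show -2 * t = -t + -t by ring, exp_add]
  field_simp
  ring
end
end
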